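/- arXiv:2501.02789 — 9 statements merged into one kernel-verified Lean document; each statement's English description precedes it below -/
import Mathlib

section
/- In Cartan's model on $\mathbb{R}^{15}$, at every point $m \in \mathbb{R}^{15}$ the fifteen vectors $X_1(m), X_2(m), X_3(m), X_4(m), Y_1(m), Y_2(m), Y_3(m), Y_4(m)$, $\tfrac12[X_i, X_j](m)$ for $1 \le i < j \le 4$, and $[Y_1, X_1](m)$ form a basis of $\mathbb{R}^{15}$. In particular, the rank-8 distribution $D$ spanned by $X_1, \dots, X_4, Y_1, \dots, Y_4$ together with the brackets of its generators spans the whole tangent space at every point, so $D$ is an $(8,15)$-distribution (i.e., $\mathcal D + [\mathcal D, \mathcal D] = \mathcal{T}\mathbb{R}^{15}$). -/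
noncomputable section

/- Coordinates on `ℝ¹⁵`:
index 0 = z, 1–4 = x₁,…,x₄, 5–8 = y₁,…,y₄,
9 = x₁₂, 10 = x₁₃, 11 = x₁₄, 12 = x₂₃, 13 = x₂₄, 14 = x₃₄. -/

/-- Standard basis vector. -/
def e (i : Fin 15) : Fin 15 → ℝ := Pi.single i 1

/-- Lie bracket of vector fields on `ℝ¹⁵`: `[V,W](x) = DW(x)(V(x)) - DV(x)(W(x))`. -/
def vfBracket (V W : (Fin 15 → ℝ) → (Fin 15 → ℝ)) : (Fin 15 → ℝ) → (Fin 15 → ℝ) :=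
  fun x => fderiv ℝ W x (V x) - fderiv ℝ V x (W x)

def X1 : (Fin 15 → ℝ) → (Fin 15 → ℝ) :=
  fun m => e 1 + m 5 • e 0 - m 2 • e 9 - m 3 • e 10 - m 4 • e 11
def X2 : (Fin 15 → ℝ) → (Fin 15 → ℝ) :=
  fun m => e 2 + m 6 • e 0 + m 1 • e 9 - m 3 • e 12 - m 4 • e 13
def X3 : (Fin 15 → ℝ) → (Fin 15 → ℝ) :=
  fun m => e 3 + m 7 • e 0 + m 1 • e 10 + m 2 • e 12 - m 4 • e 14
def X4 : (Fin 15 → ℝ) → (Fin 15 → ℝ) :=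
  fun m => e 4 + m 8 • e 0 + m 1 • e 11 + m 2 • e 13 + m 3 • e 14
def Y1 : (Fin 15 → ℝ) → (Fin 15 → ℝ) :=
  fun m => e 5 - m 8 • e 12 + m 7 • e 13 - m 6 • e 14
def Y2 : (Fin 15 → ℝ) → (Fin 15 → ℝ) :=
  fun m => e 6 + m 8 • e 10 - m 7 • e 11 + m 5 • e 14
def Y3 : (Fin 15 → ℝ) → (Fin 15 → ℝ) :=
  fun m => e 7 - m 8 • e 9 + m 6 • e 11 - m 5 • e 13
def Y4 : (Fin 15 → ℝ) → (Fin 15 → ℝ) :=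
  fun m => e 8 + m 7 • e 9 - m 6 • e 10 + m 5 • e 12

/-- The fifteen vectors `X₁(m), …, Y₄(m)`, `½[Xᵢ,Xⱼ](m)` for `i < j`, `[Y₁,X₁](m)`. -/
def frameAt (m : Fin 15 → ℝ) : Fin 15 → (Fin 15 → ℝ) :=
  ![X1 m, X2 m, X3 m, X4 m, Y1 m, Y2 m, Y3 m, Y4 m,
    (1/2 : ℝ) • vfBracket X1 X2 m, (1/2 : ℝ) • vfBracket X1 X3 m,
    (1/2 : ℝ) • vfBracket X1 X4 m, (1/2 : ℝ) • vfBracket X2 X3 m,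
    (1/2 : ℝ) • vfBracket X2 X4 m, (1/2 : ℝ) • vfBracket X3 X4 m,
    vfBracket Y1 X1 m]

/-- The derivative of an affine vector field is its linear part. -/
lemma fderiv_apply_of_affine {F : (Fin 15 → ℝ) → (Fin 15 → ℝ)}
    (hF : ∀ (a : ℝ) (x y : Fin 15 → ℝ), F (a • x + y) - F 0 = a • (F x - F 0) + (F y - F 0))
    (x v : Fin 15 → ℝ) : fderiv ℝ F x v = F v - F 0 := by
  let L : (Fin 15 → ℝ) →ₗ[ℝ] (Fin 15 → ℝ) := IsLinearMap.mk' (fun x => F x - F 0)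
    { map_add := fun x y => by simpa using hF 1 x y
      map_smul := fun a x => by simpa using hF a x 0 }
  have h : F = fun x => L.toContinuousLinearMap x + F 0 := by
    funext x
    simp [L]
  have hL : HasFDerivAt F L.toContinuousLinearMap x := by
    rw [h]
    exact L.toContinuousLinearMap.hasFDerivAt.add_const _
  rw [hL.fderiv]
  simp [L]

lemma fderiv_X1 (x v : Fin 15 → ℝ) :
    fderiv ℝ X1 x v = v 5 • e 0 - v 2 • e 9 - v 3 • e 10 - v 4 • e 11 := by
  rw [fderiv_apply_of_affine]
  · simp only [X1, Pi.zero_apply]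
    module
  · intro a x y
    simp only [X1, Pi.zero_apply, Pi.add_apply, Pi.smul_apply, smul_eq_mul]
    module

lemma fderiv_X2 (x v : Fin 15 → ℝ) :
    fderiv ℝ X2 x v = v 6 • e 0 + v 1 • e 9 - v 3 • e 12 - v 4 • e 13 := by
  rw [fderiv_apply_of_affine]
  · simp only [X2, Pi.zero_apply]
    module
  · intro a x y
    simp only [X2, Pi.zero_apply, Pi.add_apply, Pi.smul_apply, smul_eq_mul]
    module

lemma fderiv_X3 (x v : Fin 15 → ℝ) :
    fderiv ℝ X3 x v = v 7 • e 0 + v 1 • e 10 + v 2 • e 12 - v 4 • e 14 := by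
  rw [fderiv_apply_of_affine]
  · simp only [X3, Pi.zero_apply]
    module
  · intro a x y
    simp only [X3, Pi.zero_apply, Pi.add_apply, Pi.smul_apply, smul_eq_mul]
    module

lemma fderiv_X4 (x v : Fin 15 → ℝ) :
    fderiv ℝ X4 x v = v 8 • e 0 + v 1 • e 11 + v 2 • e 13 + v 3 • e 14 := by
  rw [fderiv_apply_of_affine]
  · simp only [X4, Pi.zero_apply]
    module
  · intro a x y
    simp only [X4, Pi.zero_apply, Pi.add_apply, Pi.smul_apply, smul_eq_mul]
    module

lemma fderiv_Y1 (x v : Fin 15 → ℝ) :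
    fderiv ℝ Y1 x v = v 7 • e 13 - v 8 • e 12 - v 6 • e 14 := by
  rw [fderiv_apply_of_affine]
  · simp only [Y1, Pi.zero_apply]
    module
  · intro a x y
    simp only [Y1, Pi.zero_apply, Pi.add_apply, Pi.smul_apply, smul_eq_mul]
    module

lemma half_smul_vfBracket_X1_X2 (m : Fin 15 → ℝ) :
    (1/2 : ℝ) • vfBracket X1 X2 m = e 9 := by
  simp only [vfBracket, fderiv_X1, fderiv_X2]
  simp [X1, X2, e]
  module

lemma half_smul_vfBracket_X1_X3 (m : Fin 15 → ℝ) :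
    (1/2 : ℝ) • vfBracket X1 X3 m = e 10 := by
  simp only [vfBracket, fderiv_X1, fderiv_X3]
  simp [X1, X3, e]
  module

lemma half_smul_vfBracket_X1_X4 (m : Fin 15 → ℝ) :
    (1/2 : ℝ) • vfBracket X1 X4 m = e 11 := by
  simp only [vfBracket, fderiv_X1, fderiv_X4]
  simp [X1, X4, e]
  module

lemma half_smul_vfBracket_X2_X3 (m : Fin 15 → ℝ) :
    (1/2 : ℝ) • vfBracket X2 X3 m = e 12 := by
  simp only [vfBracket, fderiv_X2, fderiv_X3]
  simp [X2, X3, e]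
  module

lemma half_smul_vfBracket_X2_X4 (m : Fin 15 → ℝ) :
    (1/2 : ℝ) • vfBracket X2 X4 m = e 13 := by
  simp only [vfBracket, fderiv_X2, fderiv_X4]
  simp [X2, X4, e]
  module

lemma half_smul_vfBracket_X3_X4 (m : Fin 15 → ℝ) :
    (1/2 : ℝ) • vfBracket X3 X4 m = e 14 := by
  simp only [vfBracket, fderiv_X3, fderiv_X4]
  simp [X3, X4, e]
  module

lemma vfBracket_Y1_X1 (m : Fin 15 → ℝ) : vfBracket Y1 X1 m = e 0 := by
  simp only [vfBracket, fderiv_Y1, fderiv_X1]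
  simp [Y1, X1, e]

lemma e_mem_span_frameAt (m : Fin 15 → ℝ) (i : Fin 15) :
    e i ∈ Submodule.span ℝ (Set.range (frameAt m)) := by
  set S := Submodule.span ℝ (Set.range (frameAt m))
  have hf (j : Fin 15) : frameAt m j ∈ S := Submodule.subset_span ⟨j, rfl⟩
  have h0 : e 0 ∈ S := vfBracket_Y1_X1 m ▸ hf 14
  have h9 : e 9 ∈ S := half_smul_vfBracket_X1_X2 m ▸ hf 8
  have h10 : e 10 ∈ S := half_smul_vfBracket_X1_X3 m ▸ hf 9
  have h11 : e 11 ∈ S := half_smul_vfBracket_X1_X4 m ▸ hf 10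
  have h12 : e 12 ∈ S := half_smul_vfBracket_X2_X3 m ▸ hf 11
  have h13 : e 13 ∈ S := half_smul_vfBracket_X2_X4 m ▸ hf 12
  have h14 : e 14 ∈ S := half_smul_vfBracket_X3_X4 m ▸ hf 13
  have h1 : e 1 ∈ S := by
    have h : e 1 = X1 m - m 5 • e 0 + m 2 • e 9 + m 3 • e 10 + m 4 • e 11 := by
      simp only [X1]
      abel
    rw [h]
    exact S.add_mem (S.add_mem (S.add_mem (S.sub_mem (hf 0) (S.smul_mem _ h0))
      (S.smul_mem _ h9)) (S.smul_mem _ h10)) (S.smul_mem _ h11)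
  have h2 : e 2 ∈ S := by
    have h : e 2 = X2 m - m 6 • e 0 - m 1 • e 9 + m 3 • e 12 + m 4 • e 13 := by
      simp only [X2]
      abel
    rw [h]
    exact S.add_mem (S.add_mem (S.sub_mem (S.sub_mem (hf 1) (S.smul_mem _ h0))
      (S.smul_mem _ h9)) (S.smul_mem _ h12)) (S.smul_mem _ h13)
  have h3 : e 3 ∈ S := by
    have h : e 3 = X3 m - m 7 • e 0 - m 1 • e 10 - m 2 • e 12 + m 4 • e 14 := by
      simp only [X3]
      abel
    rw [h]
    exact S.add_mem (S.sub_mem (S.sub_mem (S.sub_mem (hf 2) (S.smul_mem _ h0))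
      (S.smul_mem _ h10)) (S.smul_mem _ h12)) (S.smul_mem _ h14)
  have h4 : e 4 ∈ S := by
    have h : e 4 = X4 m - m 8 • e 0 - m 1 • e 11 - m 2 • e 13 - m 3 • e 14 := by
      simp only [X4]
      abel
    rw [h]
    exact S.sub_mem (S.sub_mem (S.sub_mem (S.sub_mem (hf 3) (S.smul_mem _ h0))
      (S.smul_mem _ h11)) (S.smul_mem _ h13)) (S.smul_mem _ h14)
  have h5 : e 5 ∈ S := by
    have h : e 5 = Y1 m + m 8 • e 12 - m 7 • e 13 + m 6 • e 14 := by
      simp only [Y1]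
      abel
    rw [h]
    exact S.add_mem (S.sub_mem (S.add_mem (hf 4) (S.smul_mem _ h12))
      (S.smul_mem _ h13)) (S.smul_mem _ h14)
  have h6 : e 6 ∈ S := by
    have h : e 6 = Y2 m - m 8 • e 10 + m 7 • e 11 - m 5 • e 14 := by
      simp only [Y2]
      abel
    rw [h]
    exact S.sub_mem (S.add_mem (S.sub_mem (hf 5) (S.smul_mem _ h10))
      (S.smul_mem _ h11)) (S.smul_mem _ h14)
  have h7 : e 7 ∈ S := by
    have h : e 7 = Y3 m + m 8 • e 9 - m 6 • e 11 + m 5 • e 13 := by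
      simp only [Y3]
      abel
    rw [h]
    exact S.add_mem (S.sub_mem (S.add_mem (hf 6) (S.smul_mem _ h9))
      (S.smul_mem _ h11)) (S.smul_mem _ h13)
  have h8 : e 8 ∈ S := by
    have h : e 8 = Y4 m - m 7 • e 9 + m 6 • e 10 - m 5 • e 12 := by
      simp only [Y4]
      abel
    rw [h]
    exact S.sub_mem (S.add_mem (S.sub_mem (hf 7) (S.smul_mem _ h9))
      (S.smul_mem _ h10)) (S.smul_mem _ h12)
  fin_cases i <;> assumption

/-- At every point `m` of `ℝ¹⁵`, the generators of `D` together with the brackets of the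
generators form a basis of the tangent space: `D` is an `(8,15)`-distribution. -/
theorem cartan_frame_basis :
    ∀ m : Fin 15 → ℝ,
      LinearIndependent ℝ (frameAt m) ∧
      Submodule.span ℝ (Set.range (frameAt m)) = ⊤ := by
  intro m
  have hspan : Submodule.span ℝ (Set.range (frameAt m)) = ⊤ := by
    rw [eq_top_iff, ← (Pi.basisFun ℝ (Fin 15)).span_eq, Submodule.span_le]
    rintro _ ⟨i, rfl⟩
    rw [Pi.basisFun_apply]
    exact e_mem_span_frameAt m i
  exact ⟨linearIndependent_of_top_le_span_of_card_eq_finrank hspan.ge (by simp), hspan⟩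

end
end

section
/- For all $(s, r) \in \mathbb{R}^7$ and $(u, v) \in \mathbb{R}^8$ with $A(s,r)\begin{pmatrix} u \\ v \end{pmatrix} = 0$, one has $(s^2 - 4\Delta(r))\,u = 0$ and $(s^2 - 4\Delta(r))\,v = 0$, where $\Delta(r) = r_{12}r_{34} - r_{13}r_{24} + r_{14}r_{23}$. In particular, if $(u,v) \neq (0,0)$ then $R(s,r) := s^2 - 4\Delta(r) = 0$. -/
noncomputable section

/- Coordinates: `p : Fin 7 → ℝ` stands for `(s, r₁₂, r₁₃, r₁₄, r₂₃, r₂₄, r₃₄)`,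
`w : Fin 8 → ℝ` stands for `(u₁, u₂, u₃, u₄, v₁, v₂, v₃, v₄)`. -/

def A11 (p : Fin 7 → ℝ) : Matrix (Fin 4) (Fin 4) ℝ :=
  !![0, 2*p 1, 2*p 2, 2*p 3;
     -2*p 1, 0, 2*p 4, 2*p 5;
     -2*p 2, -2*p 4, 0, 2*p 6;
     -2*p 3, -2*p 5, -2*p 6, 0]

def A22 (p : Fin 7 → ℝ) : Matrix (Fin 4) (Fin 4) ℝ :=
  !![0, 2*p 6, -2*p 5, 2*p 4;
     -2*p 6, 0, 2*p 3, -2*p 2;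
     2*p 5, -2*p 3, 0, 2*p 1;
     -2*p 4, 2*p 2, -2*p 1, 0]

/-- The `8×8` block matrix `[[A₁₁, -sI₄], [sI₄, A₂₂]]`. -/
def A (p : Fin 7 → ℝ) : Matrix (Fin 8) (Fin 8) ℝ :=
  !![0, 2*p 1, 2*p 2, 2*p 3, -p 0, 0, 0, 0;
     -2*p 1, 0, 2*p 4, 2*p 5, 0, -p 0, 0, 0;
     -2*p 2, -2*p 4, 0, 2*p 6, 0, 0, -p 0, 0;
     -2*p 3, -2*p 5, -2*p 6, 0, 0, 0, 0, -p 0;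
     p 0, 0, 0, 0, 0, 2*p 6, -2*p 5, 2*p 4;
     0, p 0, 0, 0, -2*p 6, 0, 2*p 3, -2*p 2;
     0, 0, p 0, 0, 2*p 5, -2*p 3, 0, 2*p 1;
     0, 0, 0, p 0, -2*p 4, 2*p 2, -2*p 1, 0]

/-- The `8×7` matrix `U(u,v)`. -/
def U (w : Fin 8 → ℝ) : Matrix (Fin 8) (Fin 7) ℝ :=
  !![-w 4, 2*w 1, 2*w 2, 2*w 3, 0, 0, 0;
     -w 5, -2*w 0, 0, 0, 2*w 2, 2*w 3, 0;
     -w 6, 0, -2*w 0, 0, -2*w 1, 0, 2*w 3;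
     -w 7, 0, 0, -2*w 0, 0, -2*w 1, -2*w 2;
     w 0, 0, 0, 0, 2*w 7, -2*w 6, 2*w 5;
     w 1, 0, -2*w 7, 2*w 6, 0, 0, -2*w 4;
     w 2, 2*w 7, 0, -2*w 5, 0, 2*w 4, 0;
     w 3, -2*w 6, 2*w 5, 0, -2*w 4, 0, 0]

/-- `Q(u,v) = u₁v₁ + u₂v₂ + u₃v₃ + u₄v₄`. -/
def Q (w : Fin 8 → ℝ) : ℝ := w 0 * w 4 + w 1 * w 5 + w 2 * w 6 + w 3 * w 7

/-- `Δ(r) = r₁₂r₃₄ - r₁₃r₂₄ + r₁₄r₂₃`. -/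
def Δ (p : Fin 7 → ℝ) : ℝ := p 1 * p 6 - p 2 * p 5 + p 3 * p 4

/-- `R(s,r) = s² - 4(r₁₂r₃₄ - r₁₃r₂₄ + r₁₄r₂₃)`. -/
def Rform (p : Fin 7 → ℝ) : ℝ := p 0 ^ 2 - 4 * Δ p

/-- If `A(s,r)·(u,v) = 0` then `(s² - 4Δ(r))·u = 0` and `(s² - 4Δ(r))·v = 0`; in
particular, if `(u,v) ≠ 0` then `R(s,r) = 0`. -/
theorem kernel_forces_R_zero (p : Fin 7 → ℝ) (w : Fin 8 → ℝ)
    (h : (A p).mulVec w = 0) :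
    (∀ i : Fin 8, (p 0 ^ 2 - 4 * Δ p) * w i = 0) ∧
    (w ≠ 0 → Rform p = 0) := by
  have hrow (i : Fin 8) : ((A p).mulVec w) i = 0 := congrFun h i
  have h0 := hrow 0
  have h1 := hrow 1
  have h2 := hrow 2
  have h3 := hrow 3
  have h4 := hrow 4
  have h5 := hrow 5
  have h6 := hrow 6
  have h7 := hrow 7
  clear hrow h
  simp [A, Matrix.mulVec, dotProduct, Fin.sum_univ_succ] at h0 h1 h2 h3 h4 h5 h6 h7
  have hscale : ∀ i : Fin 8, (p 0 ^ 2 - 4 * Δ p) * w i = 0 := by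
    unfold Δ
    intro i
    fin_cases i <;> dsimp
    · linear_combination p 0 * h4 + 2 * p 6 * h1 - 2 * p 5 * h2 + 2 * p 4 * h3
    · linear_combination p 0 * h5 - 2 * p 6 * h0 + 2 * p 3 * h2 - 2 * p 2 * h3
    · linear_combination p 0 * h6 + 2 * p 5 * h0 - 2 * p 3 * h1 + 2 * p 1 * h3
    · linear_combination p 0 * h7 - 2 * p 4 * h0 + 2 * p 2 * h1 - 2 * p 1 * h2
    · linear_combination -p 0 * h0 + 2 * p 1 * h5 + 2 * p 2 * h6 + 2 * p 3 * h7
    · linear_combination -p 0 * h1 - 2 * p 1 * h4 + 2 * p 4 * h6 + 2 * p 5 * h7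
    · linear_combination -p 0 * h2 - 2 * p 2 * h4 - 2 * p 4 * h5 + 2 * p 6 * h7
    · linear_combination -p 0 * h3 - 2 * p 3 * h4 - 2 * p 5 * h5 - 2 * p 6 * h6
  refine ⟨hscale, fun hw => ?_⟩
  obtain ⟨i, hi⟩ := Function.ne_iff.mp hw
  exact (mul_eq_zero.mp (hscale i)).resolve_right hi

end
end

section
/- Let $(s, r) \in \mathbb{R}^7$ be nonzero and let $(u, v) \in \mathbb{R}^8$ satisfy $A(s,r)\begin{pmatrix} u \\ v \end{pmatrix} = 0$. Then $Q(u,v) = u_1v_1 + u_2v_2 + u_3v_3 + u_4v_4 = 0$. -/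
noncomputable section

/-- If `(s,r) ≠ 0` and `A(s,r)·(u,v) = 0`, then `Q(u,v) = 0`. -/
theorem kernel_is_Q_isotropic (p : Fin 7 → ℝ) (hp : p ≠ 0)
    (w : Fin 8 → ℝ) (h : (A p).mulVec w = 0) :
    Q w = 0 := by
  have e1 := congrFun h 0
  have e2 := congrFun h 1
  have e3 := congrFun h 2
  have e4 := congrFun h 3
  have f1 := congrFun h 4
  have f2 := congrFun h 5
  have f3 := congrFun h 6
  have f4 := congrFun h 7
  simp [A, Matrix.mulVec, dotProduct, Fin.sum_univ_succ] at e1 e2 e3 e4 f1 f2 f3 f4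
  by_contra hQ
  apply hp
  have hmul : ∀ i, Q w * p i = 0 := by
    have h0 : Q w * p 0 = 0 := by
      simp only [Q]
      linear_combination -(w 0 * e1 + w 1 * e2 + w 2 * e3 + w 3 * e4)
    have h1 : Q w * p 1 = 0 := by
      simp only [Q]
      linear_combination (w 5 * e1 - w 4 * e2 + w 3 * f3 - w 2 * f4) / 2
    have h2 : Q w * p 2 = 0 := by
      simp only [Q]
      linear_combination (w 6 * e1 - w 4 * e3 + w 1 * f4 - w 3 * f2) / 2
    have h3 : Q w * p 3 = 0 := by
      simp only [Q]
      linear_combination (w 7 * e1 - w 4 * e4 + w 2 * f2 - w 1 * f3) / 2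
    have h4 : Q w * p 4 = 0 := by
      simp only [Q]
      linear_combination (w 6 * e2 - w 5 * e3 + w 3 * f1 - w 0 * f4) / 2
    have h5 : Q w * p 5 = 0 := by
      simp only [Q]
      linear_combination (w 7 * e2 - w 5 * e4 + w 0 * f3 - w 2 * f1) / 2
    have h6 : Q w * p 6 = 0 := by
      simp only [Q]
      linear_combination (w 7 * e3 - w 6 * e4 + w 1 * f1 - w 0 * f2) / 2
    intro i
    fin_cases i <;> assumption
  funext i
  exact (mul_eq_zero.mp (hmul i)).resolve_left hQ

end
end

section
/- Let $(u, v) \in \mathbb{R}^8$ be nonzero. Then there exists a nonzero $(s, r) \in \mathbb{R}^7$ with $A(s,r)\begin{pmatrix} u \\ v \end{pmatrix} = 0$ if and only if $Q(u,v) = u_1v_1 + u_2v_2 + u_3v_3 + u_4v_4 = 0$. (This is the linear-algebraic content of the determination of the singular velocity cone of Cartan's $(8,15)$-distribution: a nonzero velocity $\sum u_i X_i + \sum v_j Y_j$ is the velocity of an abnormal extremal exactly when $Q(u,v) = 0$.) -/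
noncomputable section

/-- Componentwise form of the system `A(s,r)·(u,v) = 0`. -/
lemma mulVec_A_eq_zero_iff (p : Fin 7 → ℝ) (w : Fin 8 → ℝ) :
    (A p).mulVec w = 0 ↔
      (2*p 1*w 1 + 2*p 2*w 2 + 2*p 3*w 3 - p 0*w 4 = 0 ∧
       -2*p 1*w 0 + 2*p 4*w 2 + 2*p 5*w 3 - p 0*w 5 = 0 ∧
       -2*p 2*w 0 - 2*p 4*w 1 + 2*p 6*w 3 - p 0*w 6 = 0 ∧
       -2*p 3*w 0 - 2*p 5*w 1 - 2*p 6*w 2 - p 0*w 7 = 0) ∧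
      (p 0*w 0 + 2*p 6*w 5 - 2*p 5*w 6 + 2*p 4*w 7 = 0 ∧
       p 0*w 1 - 2*p 6*w 4 + 2*p 3*w 6 - 2*p 2*w 7 = 0 ∧
       p 0*w 2 + 2*p 5*w 4 - 2*p 3*w 5 + 2*p 1*w 7 = 0 ∧
       p 0*w 3 - 2*p 4*w 4 + 2*p 2*w 5 - 2*p 1*w 6 = 0) := by
  rw [funext_iff]
  simp [A, Matrix.mulVec, dotProduct, Fin.sum_univ_succ, Fin.forall_fin_succ]
  ring_nf
  simp only [and_assoc]

/-- The coordinates `(0, a ∧ b)` of a decomposable bivector. -/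
def wedge (a b : Fin 4 → ℝ) : Fin 7 → ℝ :=
  ![0, a 0*b 1 - a 1*b 0, a 0*b 2 - a 2*b 0, a 0*b 3 - a 3*b 0,
    a 1*b 2 - a 2*b 1, a 1*b 3 - a 3*b 1, a 2*b 3 - a 3*b 2]

/-- The coordinates `(0, ⋆(a ∧ b))` of the Hodge dual of a decomposable bivector. -/
def dualWedge (a b : Fin 4 → ℝ) : Fin 7 → ℝ :=
  ![0, a 2*b 3 - a 3*b 2, -(a 1*b 3 - a 3*b 1), a 1*b 2 - a 2*b 1,
    a 0*b 3 - a 3*b 0, -(a 0*b 2 - a 2*b 0), a 0*b 1 - a 1*b 0]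

lemma mulVec_A_wedge {w : Fin 8 → ℝ} (hQ : Q w = 0) (a : Fin 4 → ℝ)
    (ha : w 0*a 0 + w 1*a 1 + w 2*a 2 + w 3*a 3 = 0) :
    (A (wedge ![w 4, w 5, w 6, w 7] a)).mulVec w = 0 := by
  unfold Q at hQ
  rw [mulVec_A_eq_zero_iff]
  simp only [wedge, Matrix.cons_val]
  refine ⟨⟨?_, ?_, ?_, ?_⟩, by ring, by ring, by ring, by ring⟩
  · linear_combination 2*w 4*ha - 2*a 0*hQ
  · linear_combination 2*w 5*ha - 2*a 1*hQ
  · linear_combination 2*w 6*ha - 2*a 2*hQ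
  · linear_combination 2*w 7*ha - 2*a 3*hQ

lemma mulVec_A_dualWedge {w : Fin 8 → ℝ}
    (h4 : w 4 = 0) (h5 : w 5 = 0) (h6 : w 6 = 0) (h7 : w 7 = 0) (a : Fin 4 → ℝ) :
    (A (dualWedge ![w 0, w 1, w 2, w 3] a)).mulVec w = 0 := by
  rw [mulVec_A_eq_zero_iff]
  simp only [dualWedge, Matrix.cons_val, h4, h5, h6, h7]
  refine ⟨⟨?_, ?_, ?_, ?_⟩, ?_, ?_, ?_, ?_⟩ <;> ring

lemma Q_eq_zero_of_mulVec_A_eq_zero {w : Fin 8 → ℝ} (hw : w ≠ 0) {p : Fin 7 → ℝ}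
    (hp : p ≠ 0) (h : (A p).mulVec w = 0) : Q w = 0 := by
  by_contra hQ
  obtain ⟨⟨x0, x1, x2, x3⟩, y0, y1, y2, y3⟩ := (mulVec_A_eq_zero_iff p w).1 h
  have cancel {x : ℝ} (hx : Q w * x = 0) : x = 0 := (mul_eq_zero.1 hx).resolve_left hQ
  -- Cartan's formula `(u·v) r = ι_u (v ∧ r) + v ∧ ι_u r`, one coordinate at a time.
  have r1 : p 1 = 0 := cancel (by
    unfold Q; linear_combination (w 5*x0 - w 4*x1 - w 2*y3 + w 3*y2)/2)
  have r2 : p 2 = 0 := cancel (by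
    unfold Q; linear_combination (w 6*x0 - w 4*x2 + w 1*y3 - w 3*y1)/2)
  have r3 : p 3 = 0 := cancel (by
    unfold Q; linear_combination (w 7*x0 - w 4*x3 - w 1*y2 + w 2*y1)/2)
  have r4 : p 4 = 0 := cancel (by
    unfold Q; linear_combination (w 6*x1 - w 5*x2 - w 0*y3 + w 3*y0)/2)
  have r5 : p 5 = 0 := cancel (by
    unfold Q; linear_combination (w 7*x1 - w 5*x3 + w 0*y2 - w 2*y0)/2)
  have r6 : p 6 = 0 := cancel (by
    unfold Q; linear_combination (w 7*x2 - w 6*x3 - w 0*y1 + w 1*y0)/2)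
  simp only [r1, r2, r3, r4, r5, r6] at x0 x1 x2 x3 y0 y1 y2 y3
  have s0 : p 0 = 0 := by
    by_contra hs
    apply hw
    funext i
    fin_cases i <;> simp_all
  apply hp
  funext i
  fin_cases i <;> assumption

lemma exists_mulVec_A_eq_zero {w : Fin 8 → ℝ} (hw : w ≠ 0) (hQ : Q w = 0) :
    ∃ p : Fin 7 → ℝ, p ≠ 0 ∧ (A p).mulVec w = 0 := by
  by_contra! hne
  have h (p : Fin 7 → ℝ) (hp : (A p).mulVec w = 0) : p = 0 := by
    by_contra hp0
    exact hne p hp0 hp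
  have par (a : Fin 4 → ℝ) (ha : w 0*a 0 + w 1*a 1 + w 2*a 2 + w 3*a 3 = 0) :=
    h _ (mulVec_A_wedge hQ a ha)
  simp only [wedge, funext_iff, Fin.forall_fin_succ, Matrix.cons_val] at par
  have a01 := par ![w 1, -w 0, 0, 0] (by simp; ring)
  have a02 := par ![w 2, 0, -w 0, 0] (by simp; ring)
  have a03 := par ![w 3, 0, 0, -w 0] (by simp; ring)
  have a12 := par ![0, w 2, -w 1, 0] (by simp; ring)
  have a13 := par ![0, w 3, 0, -w 1] (by simp; ring)
  have a23 := par ![0, 0, w 3, -w 2] (by simp; ring)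
  have b0 := par ![1, 0, 0, 0]
  have b1 := par ![0, 1, 0, 0]
  simp at a01 a02 a03 a12 a13 a23 b0 b1
  have hv : w 4 = 0 ∧ w 5 = 0 ∧ w 6 = 0 ∧ w 7 = 0 := by
    grind
  obtain ⟨h4, h5, h6, h7⟩ := hv
  have dual (a : Fin 4 → ℝ) := h _ (mulVec_A_dualWedge h4 h5 h6 h7 a)
  have d0 := dual ![1, 0, 0, 0]
  have d1 := dual ![0, 1, 0, 0]
  simp [dualWedge, funext_iff, Fin.forall_fin_succ] at d0 d1
  apply hw
  funext i
  fin_cases i <;> simp_all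

/-- Determination of the singular velocity cone of Cartan's `(8,15)`-distribution: a nonzero
velocity `(u,v)` admits a nonzero covector datum `(s,r)` with `A(s,r)·(u,v) = 0` if and only
if `Q(u,v) = 0`. -/
theorem singular_velocity_cone (w : Fin 8 → ℝ) (hw : w ≠ 0) :
    (∃ p : Fin 7 → ℝ, p ≠ 0 ∧ (A p).mulVec w = 0) ↔ Q w = 0 := by
  exact ⟨fun ⟨_, hp, h⟩ => Q_eq_zero_of_mulVec_A_eq_zero hw hp h, exists_mulVec_A_eq_zero hw⟩

end
end

section
/- Let $J$ be the $8\times8$ block matrix with blocks $0$, $I_4$ (top row) and $I_4$, $0$ (bottom row). For all $(u,v) \in \mathbb{R}^8$, $\det\bigl(U(u,v)^{\mathsf T}\, J\, U(u,v)\bigr) = 2^{13}\, Q(u,v)^7$. Consequently, if $Q(u,v) \neq 0$ then $\operatorname{rank} U(u,v) = 7$. -/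
noncomputable section

/-- The `8×8` block matrix `[[0, I₄], [I₄, 0]]`. -/
def J : Matrix (Fin 8) (Fin 8) ℝ :=
  !![0, 0, 0, 0, 1, 0, 0, 0;
     0, 0, 0, 0, 0, 1, 0, 0;
     0, 0, 0, 0, 0, 0, 1, 0;
     0, 0, 0, 0, 0, 0, 0, 1;
     1, 0, 0, 0, 0, 0, 0, 0;
     0, 1, 0, 0, 0, 0, 0, 0;
     0, 0, 1, 0, 0, 0, 0, 0;
     0, 0, 0, 1, 0, 0, 0, 0]

/-- The Gram matrix of the columns of `U(u,v)` with respect to `J`, divided by `Q(u,v)`. -/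
def gramForm : Matrix (Fin 7) (Fin 7) ℝ :=
  !![-2, 0, 0, 0, 0, 0, 0;
     0, 0, 0, 0, 0, 0, 4;
     0, 0, 0, 0, 0, -4, 0;
     0, 0, 0, 0, 4, 0, 0;
     0, 0, 0, 4, 0, 0, 0;
     0, 0, -4, 0, 0, 0, 0;
     0, 4, 0, 0, 0, 0, 0]

theorem U_transpose_mul_J (w : Fin 8 → ℝ) :
    (U w).transpose * J =
      (Matrix.of fun i j => U w (j + 4) i : Matrix (Fin 7) (Fin 8) ℝ) := by
  ext i j
  fin_cases j <;> simp [Matrix.mul_apply, Fin.sum_univ_eight, J]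

theorem U_transpose_mul_J_mul_U (w : Fin 8 → ℝ) :
    (U w).transpose * J * U w = Q w • gramForm := by
  rw [U_transpose_mul_J]
  ext i j
  fin_cases i <;> fin_cases j <;>
    simp [Matrix.mul_apply, Fin.sum_univ_eight, U, Q, gramForm] <;> ring

theorem det_gramForm : gramForm.det = 2 ^ 13 := by
  simp [gramForm, Matrix.det_succ_row_zero, Fin.sum_univ_succ, Fin.succAbove]
  norm_num

theorem Matrix.rank_eq_card_of_det_mul_ne_zero {m n K : Type*} [Fintype m] [Fintype n]
    [DecidableEq n] [Field K] (B : Matrix n m K) (C : Matrix m n K) (h : (B * C).det ≠ 0) :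
    C.rank = Fintype.card n :=
  le_antisymm C.rank_le_card_width <| by
    rw [← Matrix.rank_of_isUnit (B * C) ((Matrix.isUnit_iff_isUnit_det _).2 h.isUnit)]
    exact Matrix.rank_mul_le_right B C

/-- `det(Uᵀ J U) = 2¹³ Q⁷`; consequently `rank U(u,v) = 7` whenever `Q(u,v) ≠ 0`. -/
theorem det_UT_J_U (w : Fin 8 → ℝ) :
    ((U w).transpose * J * U w).det = 2 ^ 13 * Q w ^ 7 ∧
    (Q w ≠ 0 → (U w).rank = 7) := by
  have hdet : ((U w).transpose * J * U w).det = 2 ^ 13 * Q w ^ 7 := by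
    rw [U_transpose_mul_J_mul_U, Matrix.det_smul, det_gramForm, Fintype.card_fin, mul_comm]
  refine ⟨hdet, fun hQ => ?_⟩
  have h : ((U w).transpose * J * U w).det ≠ 0 := by
    rw [hdet]
    positivity
  simpa using Matrix.rank_eq_card_of_det_mul_ne_zero _ _ h

end
end

section
/- Let $(u,v) \in \mathbb{R}^8$ be nonzero with $Q(u,v) = 0$. Then $\operatorname{rank} U(u,v) = 4$, the kernel of $U(u,v)$ (as a linear map $\mathbb{R}^7 \to \mathbb{R}^8$) is a $3$-dimensional subspace of $\mathbb{R}^7$, and this kernel is contained in the zero set of the quadratic form $R(s,r) = s^2 - 4(r_{12}r_{34} - r_{13}r_{24} + r_{14}r_{23})$; in particular $R$ vanishes identically on $\ker U(u,v)$, i.e., $\ker U(u,v)$ is a totally isotropic subspace for the polar form of $R$. -/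
noncomputable section

/-- The symmetric polar form of `R` on `ℝ⁷`. -/
def BR (a b : Fin 7 → ℝ) : ℝ :=
  a 0 * b 0 - 2 * (a 1 * b 6 + a 6 * b 1) + 2 * (a 2 * b 5 + a 5 * b 2)
    - 2 * (a 3 * b 4 + a 4 * b 3)

open scoped Matrix

/-- The Clifford relation: a second matrix linear in `p` composes with `w ↦ U w *ᵥ p` to `R(p)`. -/
lemma Rform_smul_eq (w : Fin 8 → ℝ) (p : Fin 7 → ℝ) :
    Rform p • w =
      !![0, 2*p 6, -2*p 5, 2*p 4, p 0, 0, 0, 0;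
         -2*p 6, 0, 2*p 3, -2*p 2, 0, p 0, 0, 0;
         2*p 5, -2*p 3, 0, 2*p 1, 0, 0, p 0, 0;
         -2*p 4, 2*p 2, -2*p 1, 0, 0, 0, 0, p 0;
         -p 0, 0, 0, 0, 0, 2*p 1, 2*p 2, 2*p 3;
         0, -p 0, 0, 0, -2*p 1, 0, 2*p 4, 2*p 5;
         0, 0, -p 0, 0, -2*p 2, -2*p 4, 0, 2*p 6;
         0, 0, 0, -p 0, -2*p 3, -2*p 5, -2*p 6, 0] *ᵥ (U w *ᵥ p) := by
  ext i
  fin_cases i <;>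
    simp [U, Rform, Δ, Matrix.mulVec, dotProduct, Fin.sum_univ_succ, Fin.succ] <;> ring

lemma Q_U_mulVec (w : Fin 8 → ℝ) (p : Fin 7 → ℝ) : Q (U w *ᵥ p) = -(Rform p * Q w) := by
  simp [U, Q, Rform, Δ, Matrix.mulVec, dotProduct, Fin.sum_univ_succ, Fin.succ]
  ring

lemma Rform_eq_zero_of_U_mulVec_eq_zero {w : Fin 8 → ℝ} (hw : w ≠ 0) {p : Fin 7 → ℝ}
    (hp : U w *ᵥ p = 0) : Rform p = 0 := by
  have h := Rform_smul_eq w p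
  rw [hp, Matrix.mulVec_zero] at h
  exact (smul_eq_zero.mp h).resolve_right hw

lemma BR_eq_polar (p q : Fin 7 → ℝ) :
    BR p q = (Rform (p + q) - Rform p - Rform q) / 2 := by
  simp only [BR, Rform, Δ, Pi.add_apply]
  ring

lemma Submodule.finrank_le_of_disjoint_ker {E : Type*} [AddCommGroup E] [Module ℝ E]
    {m : ℕ} (V : Submodule ℝ E) (f : E →ₗ[ℝ] (Fin m → ℝ))
    (hf : ∀ x ∈ V, f x = 0 → x = 0) : Module.finrank ℝ V ≤ m := by
  have hinj : Function.Injective (f ∘ₗ V.subtype) :=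
    (injective_iff_map_eq_zero _).mpr fun x hx => Subtype.ext (hf x x.2 hx)
  simpa using LinearMap.finrank_le_finrank_of_injective hinj

/-- `R` has signature `(4, 3)`. -/
lemma finrank_le_three_of_Rform_eq_zero (V : Submodule ℝ (Fin 7 → ℝ))
    (hV : ∀ p ∈ V, Rform p = 0) : Module.finrank ℝ V ≤ 3 := by
  refine V.finrank_le_of_disjoint_ker
    (!![0, 1, 0, 0, 0, 0, 1; 0, 0, 1, 0, 0, -1, 0; 0, 0, 0, 1, 1, 0, 0] :
      Matrix (Fin 3) (Fin 7) ℝ).mulVecLin fun p hp h => ?_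
  have hR := hV p hp
  have h0 := congrFun h 0
  have h1 := congrFun h 1
  have h2 := congrFun h 2
  simp [Matrix.mulVec, dotProduct, Fin.sum_univ_succ, Fin.succ] at h0 h1 h2
  have e6 : p 6 = -p 1 := by linarith
  have e5 : p 5 = p 2 := by linarith
  have e4 : p 4 = -p 3 := by linarith
  simp only [Rform, Δ, e4, e5, e6] at hR
  have z0 : p 0 = 0 := by nlinarith [sq_nonneg (p 1), sq_nonneg (p 2), sq_nonneg (p 3)]
  have z1 : p 1 = 0 := by nlinarith [sq_nonneg (p 0), sq_nonneg (p 2), sq_nonneg (p 3)]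
  have z2 : p 2 = 0 := by nlinarith [sq_nonneg (p 0), sq_nonneg (p 1), sq_nonneg (p 3)]
  have z3 : p 3 = 0 := by nlinarith [sq_nonneg (p 0), sq_nonneg (p 1), sq_nonneg (p 2)]
  ext i
  fin_cases i <;> simp [z0, z1, z2, z3, e4, e5, e6]

/-- `Q` has signature `(4, 4)`. -/
lemma finrank_le_four_of_Q_eq_zero (V : Submodule ℝ (Fin 8 → ℝ))
    (hV : ∀ y ∈ V, Q y = 0) : Module.finrank ℝ V ≤ 4 := by
  refine V.finrank_le_of_disjoint_ker
    (!![1, 0, 0, 0, 1, 0, 0, 0; 0, 1, 0, 0, 0, 1, 0, 0;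
        0, 0, 1, 0, 0, 0, 1, 0; 0, 0, 0, 1, 0, 0, 0, 1] :
      Matrix (Fin 4) (Fin 8) ℝ).mulVecLin fun y hy h => ?_
  have hQ := hV y hy
  have h0 := congrFun h 0
  have h1 := congrFun h 1
  have h2 := congrFun h 2
  have h3 := congrFun h 3
  simp [Matrix.mulVec, dotProduct, Fin.sum_univ_succ, Fin.succ] at h0 h1 h2 h3
  have e4 : y 4 = -y 0 := by linarith
  have e5 : y 5 = -y 1 := by linarith
  have e6 : y 6 = -y 2 := by linarith
  have e7 : y 7 = -y 3 := by linarith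
  simp only [Q, e4, e5, e6, e7] at hQ
  have z0 : y 0 = 0 := by nlinarith [sq_nonneg (y 1), sq_nonneg (y 2), sq_nonneg (y 3)]
  have z1 : y 1 = 0 := by nlinarith [sq_nonneg (y 0), sq_nonneg (y 2), sq_nonneg (y 3)]
  have z2 : y 2 = 0 := by nlinarith [sq_nonneg (y 0), sq_nonneg (y 1), sq_nonneg (y 3)]
  have z3 : y 3 = 0 := by nlinarith [sq_nonneg (y 0), sq_nonneg (y 1), sq_nonneg (y 2)]
  ext i
  fin_cases i <;> simp [z0, z1, z2, z3, e4, e5, e6, e7]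

/-- If `(u,v) ≠ 0` and `Q(u,v) = 0`, then `rank U(u,v) = 4`, the kernel of `U(u,v)` is a
`3`-dimensional subspace of `ℝ⁷` contained in the zero set of `R`, and this kernel is
totally isotropic for the polar form of `R`. -/
theorem kernel_of_U_null (w : Fin 8 → ℝ) (hw : w ≠ 0) (hQ : Q w = 0) :
    (U w).rank = 4 ∧
    Module.finrank ℝ (LinearMap.ker (U w).mulVecLin) = 3 ∧
    (∀ p ∈ LinearMap.ker (U w).mulVecLin, Rform p = 0) ∧
    (∀ p ∈ LinearMap.ker (U w).mulVecLin, ∀ q ∈ LinearMap.ker (U w).mulVecLin,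
      BR p q = 0) := by
  have hR : ∀ p ∈ LinearMap.ker (U w).mulVecLin, Rform p = 0 := fun p hp =>
    Rform_eq_zero_of_U_mulVec_eq_zero hw (by simpa using hp)
  have hker := finrank_le_three_of_Rform_eq_zero _ hR
  have hrange : (U w).rank ≤ 4 := by
    refine finrank_le_four_of_Q_eq_zero (LinearMap.range (U w).mulVecLin) ?_
    rintro _ ⟨p, rfl⟩
    simp [Q_U_mulVec, hQ]
  have hsum : (U w).rank + Module.finrank ℝ (LinearMap.ker (U w).mulVecLin) = 7 := by
    simpa [Matrix.rank] using (U w).mulVecLin.finrank_range_add_finrank_ker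
  refine ⟨by omega, by omega, hR, fun p hp q hq => ?_⟩
  rw [BR_eq_polar, hR _ (add_mem hp hq), hR p hp, hR q hq]
  norm_num

end
end

section
/- Let $(s,r) \in \mathbb{R}^7$ be nonzero with $R(s,r) = s^2 - 4(r_{12}r_{34} - r_{13}r_{24} + r_{14}r_{23}) = 0$. Then $\operatorname{rank} A(s,r) = 4$, and the kernel of $A(s,r)$ is a $4$-dimensional subspace of $\mathbb{R}^8$ on which the quadratic form $Q(u,v) = u_1v_1 + u_2v_2 + u_3v_3 + u_4v_4$ vanishes identically (a totally isotropic $4$-space for $Q$). Thus to every null line in the null cone of $R$ there corresponds a null $4$-space in the null cone of $Q$. -/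
noncomputable section

open scoped Matrix

/-- The Hodge dual of `(s,r)`, with the sign of `s` reversed. -/
def hodgeDual (p : Fin 7 → ℝ) : Fin 7 → ℝ := ![-p 0, p 6, -p 5, p 4, p 3, -p 2, p 1]

lemma Rform_hodgeDual (p : Fin 7 → ℝ) : Rform (hodgeDual p) = Rform p := by
  simp [Rform, Δ, hodgeDual]
  ring

/-- Passing to the Hodge dual exchanges the `u` and `v` coordinates. -/
lemma A_hodgeDual (p : Fin 7 → ℝ) :
    A (hodgeDual p) = (A p).submatrix (Equiv.addRight 4) (Equiv.addRight 4) := by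
  ext i j
  fin_cases i <;> fin_cases j <;> simp [A, hodgeDual]

lemma A_mulVec_A_hodgeDual_mulVec (p : Fin 7 → ℝ) (z : Fin 8 → ℝ) :
    A p *ᵥ (A (hodgeDual p) *ᵥ z) = Rform p • z := by
  ext i
  fin_cases i <;>
    simp [A, hodgeDual, Rform, Δ, dotProduct, Fin.sum_univ_eight] <;> ring

lemma A_sq_add_A_hodgeDual_sq_mulVec (p : Fin 7 → ℝ) (z : Fin 8 → ℝ) :
    A p *ᵥ (A p *ᵥ z) + A (hodgeDual p) *ᵥ (A (hodgeDual p) *ᵥ z) =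
      (-(2 * p 0 ^ 2 + 4 * (p 1 ^ 2 + p 2 ^ 2 + p 3 ^ 2 + p 4 ^ 2 + p 5 ^ 2 + p 6 ^ 2))) • z := by
  ext i
  fin_cases i <;>
    simp [A, hodgeDual, dotProduct, Fin.sum_univ_eight] <;> ring

lemma two_mul_sq_add_four_mul_sum_sq_ne_zero {p : Fin 7 → ℝ} (hp : p ≠ 0) :
    2 * p 0 ^ 2 + 4 * (p 1 ^ 2 + p 2 ^ 2 + p 3 ^ 2 + p 4 ^ 2 + p 5 ^ 2 + p 6 ^ 2) ≠ 0 := by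
  refine fun h => hp ?_
  ext i
  rw [Pi.zero_apply, ← sq_eq_zero_iff]
  fin_cases i <;> simp only [Fin.reduceFinMk, Fin.zero_eta, Fin.mk_one] <;>
    linarith [sq_nonneg (p 0), sq_nonneg (p 1), sq_nonneg (p 2), sq_nonneg (p 3),
      sq_nonneg (p 4), sq_nonneg (p 5), sq_nonneg (p 6)]

lemma Q_A_mulVec (p : Fin 7 → ℝ) (z : Fin 8 → ℝ) : Q (A p *ᵥ z) = -Rform p * Q z := by
  simp [A, Q, Rform, Δ, Matrix.mulVec, dotProduct, Fin.sum_univ_eight]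
  ring

lemma range_A_hodgeDual {p : Fin 7 → ℝ} (hp : p ≠ 0) (hR : Rform p = 0) :
    LinearMap.range (A (hodgeDual p)).mulVecLin = LinearMap.ker (A p).mulVecLin := by
  apply le_antisymm
  · rintro _ ⟨z, rfl⟩
    rw [LinearMap.mem_ker, Matrix.mulVecLin_apply, Matrix.mulVecLin_apply,
      A_mulVec_A_hodgeDual_mulVec, hR, zero_smul]
  · intro w hw
    rw [LinearMap.mem_ker, Matrix.mulVecLin_apply] at hw
    have h := A_sq_add_A_hodgeDual_sq_mulVec p w
    rw [hw, Matrix.mulVec_zero, zero_add] at h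
    rw [← Submodule.smul_mem_iff _ (neg_ne_zero.mpr (two_mul_sq_add_four_mul_sum_sq_ne_zero hp)),
      ← h]
    exact LinearMap.mem_range_self (A (hodgeDual p)).mulVecLin _

/-- If `(s,r) ≠ 0` and `R(s,r) = 0`, then `rank A(s,r) = 4` and the kernel of `A(s,r)` is a
`4`-dimensional subspace of `ℝ⁸` on which `Q` vanishes identically: to every null line in
the null cone of `R` there corresponds a null `4`-space in the null cone of `Q`. -/
theorem kernel_of_A_null (p : Fin 7 → ℝ) (hp : p ≠ 0) (hR : Rform p = 0) :
    (A p).rank = 4 ∧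
    Module.finrank ℝ (LinearMap.ker (A p).mulVecLin) = 4 ∧
    (∀ w ∈ LinearMap.ker (A p).mulVecLin, Q w = 0) := by
  have hrange := range_A_hodgeDual hp hR
  have hrank : Module.finrank ℝ (LinearMap.ker (A p).mulVecLin) = (A p).rank := by
    rw [← hrange, ← Matrix.rank, A_hodgeDual, Matrix.rank_submatrix]
  have hsum : (A p).rank + Module.finrank ℝ (LinearMap.ker (A p).mulVecLin) = 8 := by
    rw [Matrix.rank, LinearMap.finrank_range_add_finrank_ker, Module.finrank_fin_fun]
  refine ⟨by omega, by omega, fun w hw => ?_⟩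
  rw [← hrange] at hw
  obtain ⟨z, rfl⟩ := hw
  rw [Matrix.mulVecLin_apply, Q_A_mulVec, Rform_hodgeDual, hR, neg_zero, zero_mul]

end
end

section
/- For every $(s,r) \in \mathbb{R}^7$, the $8\times8$ matrix $A(s,r)$ is invertible if and only if $R(s,r) = s^2 - 4(r_{12}r_{34} - r_{13}r_{24} + r_{14}r_{23}) \neq 0$. -/
noncomputable section

theorem A11_mul_A22 (p : Fin 7 → ℝ) :
    A11 p * A22 p = (-4 * Δ p) • (1 : Matrix (Fin 4) (Fin 4) ℝ) := by
  ext i j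
  fin_cases i <;> fin_cases j <;>
    simp [A11, A22, Δ, Matrix.mul_apply, Fin.sum_univ_four] <;> ring

theorem A22_mul_A11 (p : Fin 7 → ℝ) :
    A22 p * A11 p = (-4 * Δ p) • (1 : Matrix (Fin 4) (Fin 4) ℝ) := by
  ext i j
  fin_cases i <;> fin_cases j <;>
    simp [A11, A22, Δ, Matrix.mul_apply, Fin.sum_univ_four] <;> ring

/-- The block form of `A(s,r)`. -/
def blockA (p : Fin 7 → ℝ) : Matrix (Fin 4 ⊕ Fin 4) (Fin 4 ⊕ Fin 4) ℝ :=
  Matrix.fromBlocks (A11 p) (-(p 0 • 1)) (p 0 • 1) (A22 p)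

theorem A_submatrix_finSumFinEquiv (p : Fin 7 → ℝ) :
    (A p).submatrix (finSumFinEquiv (m := 4) (n := 4)) (finSumFinEquiv (m := 4) (n := 4)) =
      blockA p := by
  ext i j
  rcases i with i | i <;> rcases j with j | j
  · fin_cases i <;> fin_cases j <;> rfl
  · fin_cases i <;> fin_cases j <;> simp [blockA] <;> rfl
  · fin_cases i <;> fin_cases j <;> simp [blockA] <;> rfl
  · fin_cases i <;> fin_cases j <;> rfl

/-- Swapping the two diagonal blocks of `A(s,r)` yields `R(s,r)` times its inverse. -/
theorem blockA_mul_swap (p : Fin 7 → ℝ) :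
    blockA p * (blockA p).submatrix (Equiv.sumComm _ _) (Equiv.sumComm _ _) =
      Rform p • (1 : Matrix (Fin 4 ⊕ Fin 4) (Fin 4 ⊕ Fin 4) ℝ) := by
  have h : (blockA p).submatrix (Equiv.sumComm _ _) (Equiv.sumComm _ _) =
      Matrix.fromBlocks (A22 p) (p 0 • 1) (-(p 0 • 1)) (A11 p) :=
    Matrix.fromBlocks_submatrix_sum_swap_sum_swap _ _ _ _
  rw [h, blockA, Matrix.fromBlocks_multiply, ← Matrix.fromBlocks_one, Matrix.fromBlocks_smul,
    A11_mul_A22, A22_mul_A11]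
  congr 1
  · simp only [Matrix.neg_mul, Matrix.mul_neg, neg_neg, smul_mul_smul_comm, mul_one, ← add_smul]
    congr 1
    rw [Rform]
    ring
  · simp
  · simp
  · simp only [smul_mul_smul_comm, mul_one, ← add_smul]
    congr 1
    rw [Rform]
    ring

theorem det_blockA_mul_self (p : Fin 7 → ℝ) :
    (blockA p).det * (blockA p).det = Rform p ^ 8 := by
  have h := congrArg Matrix.det (blockA_mul_swap p)
  rw [Matrix.det_mul, Matrix.det_submatrix_equiv_self, Matrix.det_smul, Matrix.det_one] at h
  simpa using h

/-- `A(s,r)` is invertible if and only if `R(s,r) ≠ 0`. -/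
theorem A_invertible_iff (p : Fin 7 → ℝ) :
    IsUnit (A p) ↔ Rform p ≠ 0 := by
  rw [Matrix.isUnit_iff_isUnit_det,
    ← Matrix.det_submatrix_equiv_self (finSumFinEquiv (m := 4) (n := 4)) (A p),
    A_submatrix_finSumFinEquiv, isUnit_iff_ne_zero, ← mul_self_ne_zero, det_blockA_mul_self,
    pow_ne_zero_iff (by norm_num)]

end
end

section
/- Let $(z_{11}, z_{13}, z_{14}, z_{15}, z_{16}) \in \mathbb{R}^5$ and set $z_{17} = \tfrac14 z_{11}^2 + z_{13}z_{16} - z_{14}z_{15}$, so that the vector $f_1 = (z_{11}, 1, z_{13}, z_{14}, z_{15}, z_{16}, z_{17}) \in \mathbb{R}^7$ satisfies $R(f_1) = 0$. Then the kernel of the $8\times8$ matrix $A(f_1)$ is exactly the $4$-dimensional subspace of $\mathbb{R}^8$ spanned by the four linearly independent vectors $w_1 = (z_{15}, -z_{13}, 1, 0, 0, 0, 0, -\tfrac12 z_{11})$, $w_2 = (z_{16}, -z_{14}, 0, 1, 0, 0, \tfrac12 z_{11}, 0)$, $w_3 = (0, \tfrac12 z_{11}, 0, 0, 1, 0, -z_{15},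 -z_{16})$, $w_4 = (-\tfrac12 z_{11}, 0, 0, 0, 0, 1, z_{13}, z_{14})$, and the quadratic form $Q(u,v) = u_1v_1 + u_2v_2 + u_3v_3 + u_4v_4$ vanishes identically on this subspace. -/
noncomputable section

/-- For `f₁ = (z₁₁, 1, z₁₃, z₁₄, z₁₅, z₁₆, z₁₇)` with
`z₁₇ = ¼z₁₁² + z₁₃z₁₆ - z₁₄z₁₅` one has `R(f₁) = 0`, and the kernel of `A(f₁)` is exactly
the `4`-dimensional subspace spanned by the four linearly independent vectors
`w₁, w₂, w₃, w₄`, on which `Q` vanishes identically. -/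
theorem kernel_of_A_for_null_line (z11 z13 z14 z15 z16 : ℝ) :
    let z17 : ℝ := (1/4) * z11 ^ 2 + z13 * z16 - z14 * z15
    let f1 : Fin 7 → ℝ := ![z11, 1, z13, z14, z15, z16, z17]
    let w1 : Fin 8 → ℝ := ![z15, -z13, 1, 0, 0, 0, 0, -(1/2) * z11]
    let w2 : Fin 8 → ℝ := ![z16, -z14, 0, 1, 0, 0, (1/2) * z11, 0]
    let w3 : Fin 8 → ℝ := ![0, (1/2) * z11, 0, 0, 1, 0, -z15, -z16]
    let w4 : Fin 8 → ℝ := ![-(1/2) * z11, 0, 0, 0, 0, 1, z13, z14]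
    Rform f1 = 0 ∧
    LinearIndependent ℝ ![w1, w2, w3, w4] ∧
    LinearMap.ker (A f1).mulVecLin = Submodule.span ℝ {w1, w2, w3, w4} ∧
    (∀ w ∈ Submodule.span ℝ ({w1, w2, w3, w4} : Set (Fin 8 → ℝ)), Q w = 0) := by
  intro z17 f1 w1 w2 w3 w4
  have mem_span (w : Fin 8 → ℝ) : w ∈ Submodule.span ℝ ({w1, w2, w3, w4} : Set (Fin 8 → ℝ)) ↔
      ∃ a b c d : ℝ, w = a • w1 + b • w2 + c • w3 + d • w4 := by
    simp only [Submodule.mem_span_insert, Submodule.mem_span_singleton]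
    constructor
    · rintro ⟨a, _, ⟨b, _, ⟨c, _, ⟨d, rfl⟩, rfl⟩, rfl⟩, rfl⟩
      exact ⟨a, b, c, d, by simp only [add_assoc]⟩
    · rintro ⟨a, b, c, d, rfl⟩
      exact ⟨a, _, ⟨b, _, ⟨c, _, ⟨d, rfl⟩, rfl⟩, rfl⟩, by simp only [add_assoc]⟩
  refine ⟨?_, ?_, ?_, ?_⟩
  · simp [Rform, Δ, f1, z17]
    ring
  · rw [Fintype.linearIndependent_iff]
    intro g hg
    have h2 := congrFun hg 2
    have h3 := congrFun hg 3
    have h4 := congrFun hg 4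
    have h5 := congrFun hg 5
    simp [Fin.sum_univ_four, w1, w2, w3, w4] at h2 h3 h4 h5
    intro i
    fin_cases i <;> assumption
  · ext x
    rw [mem_span, LinearMap.mem_ker, Matrix.mulVecLin_apply]
    constructor
    · intro h
      have h0 := congrFun h 0
      have h1 := congrFun h 1
      have h6 := congrFun h 6
      have h7 := congrFun h 7
      simp [A, f1, Matrix.mulVec, dotProduct, Fin.sum_univ_eight] at h0 h1 h6 h7
      refine ⟨x 2, x 3, x 4, x 5, ?_⟩
      ext i
      fin_cases i <;> simp [w1, w2, w3, w4] <;> linarith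
    · rintro ⟨a, b, c, d, rfl⟩
      ext i
      fin_cases i <;>
        simp [A, f1, z17, w1, w2, w3, w4, Matrix.mulVec, dotProduct, Fin.sum_univ_eight] <;>
        ring
  · intro w hw
    obtain ⟨a, b, c, d, rfl⟩ := (mem_span w).1 hw
    simp [Q, w1, w2, w3, w4]
    ring

end
end
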